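/- arXiv:1306.0631 — 3 statements merged into one kernel-verified Lean document; each statement's English description precedes it below -/
import Mathlib

section
/- For every ε, p, q > 0, the smoothed function w^sym_ε(z; p, q) = ∫_{−∞}^∞ u_ε(z − y) w^sym(y; p, q) dy, where u_ε(z) = (1/(√(2π) ε)) exp(−z²/(2ε²)) and the integral is over y ∈ ℝ, is an entire function of z, i.e., it is complex differentiable at every z ∈ ℂ. -/
open Real Complex Filter MeasureTheory

noncomputable section

/-- The complementary error function, extended to complex arguments by integrating
`e^{-s²}` along the horizontal path from `z` to `+∞`. -/
def erfcC (z : ℂ) : ℂ :=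
  (2 / Real.sqrt π) * ∫ t in Set.Ioi (0 : ℝ), Complex.exp (-(z + t) ^ 2)

/-- Ooura's weight `w(z; p, q) = (1/2) erfc(z/p - q)` for complex `z`. -/
def wC (p q : ℝ) (z : ℂ) : ℂ := (1 / 2) * erfcC (z / p - q)

/-- The symmetrized weight `w^sym(z; p, q)`. -/
def wSym (p q : ℝ) (z : ℂ) : ℂ := if 0 ≤ z.re then wC p q z else wC p q (-z)

/-- The Gaussian mollifier `u_ε`. -/
def uEps (ε : ℝ) (z : ℂ) : ℂ :=
  (1 / (Real.sqrt (2 * π) * ε)) * Complex.exp (-z ^ 2 / (2 * ε ^ 2))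

/-- The smoothed symmetrized weight `w^sym_ε(z; p, q) = ∫_ℝ u_ε(z - y) w^sym(y; p, q) dy`. -/
def wSymEps (ε p q : ℝ) (z : ℂ) : ℂ :=
  ∫ y : ℝ, uEps ε (z - y) * wSym p q (y : ℂ)

theorem measurable_erfcC : Measurable erfcC := by
  have h : StronglyMeasurable (fun x : ℂ × ℝ => Complex.exp (-(x.1 + x.2) ^ 2)) :=
    Continuous.stronglyMeasurable (by fun_prop)
  exact (h.integral_prod_right' (ν := volume.restrict (Set.Ioi (0 : ℝ)))).measurable.const_mul _

theorem measurable_wSym (p q : ℝ) : Measurable (wSym p q) := by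
  have h : Measurable (wC p q) :=
    (measurable_erfcC.comp (by fun_prop : Measurable fun z : ℂ => z / p - q)).const_mul _
  exact Measurable.ite (measurableSet_le measurable_const Complex.measurable_re) h
    (h.comp measurable_neg)

theorem norm_erfcC_ofReal_le (x : ℝ) :
    ‖erfcC x‖ ≤ ‖(2 / Real.sqrt π : ℂ)‖ * ∫ t : ℝ, Real.exp (-1 * t ^ 2) := by
  rw [erfcC, norm_mul]
  gcongr
  have hint : Integrable fun t : ℝ => Real.exp (-1 * t ^ 2) :=
    integrable_exp_neg_mul_sq one_pos
  calc ‖∫ t in Set.Ioi (0 : ℝ), Complex.exp (-((x : ℂ) + t) ^ 2)‖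
      ≤ ∫ t in Set.Ioi (0 : ℝ), ‖Complex.exp (-((x : ℂ) + t) ^ 2)‖ :=
        norm_integral_le_integral_norm _
    _ = ∫ t in Set.Ioi (0 : ℝ), Real.exp (-1 * (x + t) ^ 2) := by
        congr 1 with t
        rw [Complex.norm_exp, neg_one_mul]
        congr 1
        norm_cast
    _ ≤ ∫ t : ℝ, Real.exp (-1 * (x + t) ^ 2) :=
        setIntegral_le_integral (hint.comp_add_left x) (ae_of_all _ fun t => (Real.exp_pos _).le)
    _ = ∫ t : ℝ, Real.exp (-1 * t ^ 2) :=
        integral_add_left_eq_self (fun t : ℝ => Real.exp (-1 * t ^ 2)) x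

theorem exists_norm_wSym_ofReal_le (p q : ℝ) : ∃ K, ∀ y : ℝ, ‖wSym p q y‖ ≤ K := by
  refine ⟨‖(1 / 2 : ℂ)‖ * (‖(2 / Real.sqrt π : ℂ)‖ * ∫ t : ℝ, Real.exp (-1 * t ^ 2)), fun y => ?_⟩
  have h (x : ℝ) : ‖wC p q x‖ ≤
      ‖(1 / 2 : ℂ)‖ * (‖(2 / Real.sqrt π : ℂ)‖ * ∫ t : ℝ, Real.exp (-1 * t ^ 2)) := by
    rw [wC, norm_mul]
    gcongr
    exact_mod_cast norm_erfcC_ofReal_le (x / p - q)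
  rw [wSym]
  split_ifs
  · exact h y
  · exact_mod_cast h (-y)

theorem integrable_exp_mul_abs_sub_mul_sq {b : ℝ} (hb : 0 < b) (M : ℝ) :
    Integrable fun y : ℝ => Real.exp (M * |y| - b * y ^ 2) := by
  have h (c : ℝ) : Integrable fun y : ℝ => Real.exp (c * y - b * y ^ 2) := by
    have := (integrable_cexp_quadratic (b := (b : ℂ)) (by simpa using hb) c 0).norm
    refine this.congr (ae_of_all _ fun y => ?_)
    simp only [Complex.norm_exp]
    congr 1
    norm_cast
    simp
    ring
  refine ((h M).add (h (-M))).mono' (Continuous.aestronglyMeasurable (by fun_prop))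
    (ae_of_all _ fun y => ?_)
  rw [Real.norm_of_nonneg (Real.exp_pos _).le, Pi.add_apply]
  rcases abs_cases y with ⟨hy, -⟩ | ⟨hy, -⟩ <;> rw [hy]
  · exact le_add_of_nonneg_right (Real.exp_pos _).le
  · rw [mul_neg, ← neg_mul]
    exact le_add_of_nonneg_left (Real.exp_pos _).le

/-- The Laplace transform of a bounded function times a Gaussian is entire. -/
theorem differentiable_integral_exp_mul_sub_mul_sq {b : ℝ} (hb : 0 < b) {f : ℝ → ℂ}
    (hf : Measurable f) {K : ℝ} (hK : ∀ y, ‖f y‖ ≤ K) :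
    Differentiable ℂ fun z : ℂ => ∫ y : ℝ, Complex.exp (z * y - b * y ^ 2) * f y := by
  intro z₀
  have hexp (z : ℂ) (y : ℝ) : ‖Complex.exp (z * y - b * y ^ 2)‖ ≤
      Real.exp (‖z‖ * |y| - b * y ^ 2) := by
    have h : (z * y - b * y ^ 2 : ℂ).re = z.re * y - b * y ^ 2 := by
      simp [← Complex.ofReal_pow]
    rw [Complex.norm_exp, h]
    have h' : z.re * y ≤ ‖z‖ * |y| := by
      refine (le_abs_self _).trans ?_
      rw [abs_mul]
      gcongr
      exact Complex.abs_re_le_norm z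
    gcongr
  have hmeas (z : ℂ) : Measurable fun y : ℝ => Complex.exp (z * y - b * y ^ 2) * f y :=
    Measurable.mul (Continuous.measurable (by fun_prop)) hf
  refine (hasDerivAt_integral_of_dominated_loc_of_deriv_le
    (F := fun (z : ℂ) (y : ℝ) => Complex.exp (z * y - b * y ^ 2) * f y)
    (F' := fun (z : ℂ) (y : ℝ) => y * (Complex.exp (z * y - b * y ^ 2) * f y))
    (bound := fun y => Real.exp ((‖z₀‖ + 2) * |y| - b * y ^ 2) * K)
    (Metric.ball_mem_nhds z₀ one_pos)
    (Eventually.of_forall fun z => (hmeas z).aestronglyMeasurable) ?_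
    (Complex.measurable_ofReal.mul (hmeas z₀)).aestronglyMeasurable
    (ae_of_all _ fun y z hz => ?_)
    ((integrable_exp_mul_abs_sub_mul_sq hb _).mul_const K)
    (ae_of_all _ fun y z _ => ?_)).2.differentiableAt
  · refine ((integrable_exp_mul_abs_sub_mul_sq hb ‖z₀‖).mul_const K).mono'
      (hmeas z₀).aestronglyMeasurable (ae_of_all _ fun y => ?_)
    rw [norm_mul]
    gcongr
    exacts [hexp z₀ y, hK y]
  · have hz' : ‖z‖ ≤ ‖z₀‖ + 1 := by
      have := norm_sub_norm_le z z₀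
      rw [mem_ball_iff_norm] at hz
      linarith
    rw [norm_mul, norm_mul, ← mul_assoc, Complex.norm_real, Real.norm_eq_abs]
    gcongr
    · calc |y| * ‖Complex.exp (z * y - b * y ^ 2)‖
          ≤ Real.exp |y| * Real.exp ((‖z₀‖ + 1) * |y| - b * y ^ 2) := by
            gcongr
            · linarith [Real.add_one_le_exp |y|]
            · exact (hexp z y).trans (by gcongr)
        _ = Real.exp ((‖z₀‖ + 2) * |y| - b * y ^ 2) := by
            rw [← Real.exp_add]
            ring_nf
    · exact hK y
  · have h : HasDerivAt (fun z : ℂ => z * y - b * y ^ 2) (y : ℂ) z := by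
      simpa using ((hasDerivAt_id z).mul_const (y : ℂ)).sub_const ((b : ℂ) * y ^ 2)
    exact (h.cexp.mul_const (f y)).congr_deriv (by ring)

theorem wSymEps_eq {ε : ℝ} (hε : 0 < ε) (p q : ℝ) (z : ℂ) :
    wSymEps ε p q z = uEps ε z * ∫ y : ℝ,
      Complex.exp (z / ε ^ 2 * y - (1 / (2 * ε ^ 2) : ℝ) * y ^ 2) * wSym p q y := by
  rw [wSymEps, ← integral_const_mul]
  congr 1 with y
  have hε' : (ε : ℂ) ≠ 0 := by exact_mod_cast hε.ne'
  rw [uEps, uEps, mul_assoc, mul_assoc, ← mul_assoc (Complex.exp _), ← Complex.exp_add]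
  congr 3
  push_cast
  field_simp
  ring

theorem stmt4 (ε p q : ℝ) (hε : 0 < ε) (hp : 0 < p) (hq : 0 < q) :
    Differentiable ℂ (wSymEps ε p q) := by
  obtain ⟨K, hK⟩ := exists_norm_wSym_ofReal_le p q
  have hL := differentiable_integral_exp_mul_sub_mul_sq (b := 1 / (2 * ε ^ 2)) (by positivity)
    ((measurable_wSym p q).comp Complex.measurable_ofReal) hK
  have hu : Differentiable ℂ (uEps ε) := by
    unfold uEps
    fun_prop
  rw [funext (wSymEps_eq hε p q)]
  exact hu.mul (hL.comp (by fun_prop : Differentiable ℂ fun z : ℂ => z / (ε : ℂ) ^ 2))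
end
end

section
/- Let p, q, h, ε > 0 and v ≥ 0. Then h · Σ_{n=−∞}^{∞} |w(|nh − εv|; p, q) − w(|nh|; p, q)| ≤ (εv/(√π p)) · ( √π p + 2h + 2pq + εv ). -/
open Real MeasureTheory

noncomputable section

/-- The complementary error function on the reals. -/
def erfcR (x : ℝ) : ℝ := (2 / Real.sqrt π) * ∫ t in Set.Ioi x, Real.exp (-t ^ 2)

/-- Ooura's continuous Euler transform weight `w(x; p, q) = (1/2) erfc(x/p - q)`. -/
def wFn (p q x : ℝ) : ℝ := (1 / 2) * erfcR (x / p - q)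

/-- A Gaussian whose left half is replaced by the constant `1`. -/
def plateauGaussian (t : ℝ) : ℝ := Real.exp (-(max t 0) ^ 2)

lemma plateauGaussian_nonneg (t : ℝ) : 0 ≤ plateauGaussian t := (Real.exp_pos _).le

lemma plateauGaussian_le_one (t : ℝ) : plateauGaussian t ≤ 1 := by
  unfold plateauGaussian
  rw [Real.exp_le_one_iff]
  nlinarith [sq_nonneg (max t 0)]

lemma continuous_plateauGaussian : Continuous plateauGaussian := by
  unfold plateauGaussian
  fun_prop

lemma antitone_plateauGaussian : Antitone plateauGaussian := by
  intro s t hst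
  unfold plateauGaussian
  have : max s 0 ≤ max t 0 := max_le_max_right 0 hst
  have h0 : 0 ≤ max s 0 := le_max_right _ _
  gcongr

lemma exp_neg_sq_le_plateauGaussian (t : ℝ) : Real.exp (-t ^ 2) ≤ plateauGaussian t := by
  unfold plateauGaussian
  rcases le_total t 0 with ht | ht
  · rw [max_eq_right ht]
    exact Real.exp_le_exp.mpr (by nlinarith [sq_nonneg t])
  · rw [max_eq_left ht]

lemma integrable_exp_neg_sq : Integrable fun t : ℝ => Real.exp (-t ^ 2) := by
  simpa using integrable_exp_neg_mul_sq (b := 1) one_pos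

lemma intervalIntegral_plateauGaussian_le {A B Q : ℝ} (hQ : 0 ≤ Q) (hA : -Q ≤ A) (hAB : A ≤ B) :
    ∫ t in A..B, plateauGaussian t ≤ Q + √π / 2 := by
  have hintegral : ∀ a b, IntervalIntegrable plateauGaussian volume a b :=
    fun a b => continuous_plateauGaussian.intervalIntegrable a b
  have hB : 0 ≤ max B 0 := le_max_right _ _
  have hmono : ∫ t in A..B, plateauGaussian t ≤ ∫ t in (-Q)..(max B 0), plateauGaussian t :=
    intervalIntegral.integral_mono_interval hA hAB (le_max_left _ _)
      (Filter.Eventually.of_forall plateauGaussian_nonneg) (hintegral _ _)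
  have hleft : ∫ t in (-Q)..0, plateauGaussian t ≤ Q := by
    calc ∫ t in (-Q)..0, plateauGaussian t ≤ ∫ _ in (-Q)..0, (1 : ℝ) :=
          intervalIntegral.integral_mono_on (by linarith) (hintegral _ _)
            intervalIntegrable_const fun t _ => plateauGaussian_le_one t
      _ = Q := by simp
  have hright : ∫ t in (0 : ℝ)..(max B 0), plateauGaussian t ≤ √π / 2 := by
    calc ∫ t in (0 : ℝ)..(max B 0), plateauGaussian t
        = ∫ t in Set.Ioc 0 (max B 0), Real.exp (-t ^ 2) := by
          rw [intervalIntegral.integral_of_le hB]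
          refine setIntegral_congr_fun measurableSet_Ioc fun t ht => ?_
          simp only [plateauGaussian, max_eq_left ht.1.le]
      _ ≤ ∫ t in Set.Ioi 0, Real.exp (-t ^ 2) :=
          setIntegral_mono_set integrable_exp_neg_sq.integrableOn
            (Filter.Eventually.of_forall fun t => (Real.exp_pos _).le)
            (Filter.Eventually.of_forall fun t ht => ht.1)
      _ = √π / 2 := by simpa using integral_gaussian_Ioi 1
  have := intervalIntegral.integral_add_adjacent_intervals (hintegral (-Q) 0) (hintegral 0 (max B 0))
  linarith

lemma sum_range_plateauGaussian_le {a p Q h : ℝ} (ha : 0 ≤ a) (hp : 0 < p) (hQ : 0 ≤ Q)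
    (hh : 0 < h) (N : ℕ) :
    ∑ k ∈ Finset.range N, plateauGaussian ((a + k * h) / p - Q) ≤
      1 + p / h * (Q + √π / 2) := by
  have hC : 0 ≤ p / h * (Q + √π / 2) := by positivity
  cases N with
  | zero => simpa using by linarith
  | succ N =>
    have hform : ∀ y : ℝ, (a + y * h) / p - Q = h / p * y + (a / p - Q) := fun y => by ring
    have hanti : Antitone fun y : ℝ => plateauGaussian ((a + y * h) / p - Q) := by
      intro y z hyz
      apply antitone_plateauGaussian
      gcongr
    have hsum := (hanti.antitoneOn (Set.Icc (0 : ℝ) (0 + N))).sum_le_integral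
    have hintegral : ∫ y in (0 : ℝ)..(0 + N), plateauGaussian ((a + y * h) / p - Q) ≤
        p / h * (Q + √π / 2) := by
      simp only [hform]
      rw [intervalIntegral.integral_comp_mul_add _ (by positivity), smul_eq_mul, inv_div]
      gcongr
      apply intervalIntegral_plateauGaussian_le hQ
      · have : 0 ≤ a / p := by positivity
        linarith
      · gcongr
        linarith [N.cast_nonneg (α := ℝ)]
    rw [Finset.sum_range_succ']
    have h1 := plateauGaussian_le_one ((a + (0 : ℕ) * h) / p - Q)
    simp only [zero_add] at hsum hintegral
    linarith

lemma summable_plateauGaussian {a p Q h : ℝ} (ha : 0 ≤ a) (hp : 0 < p) (hQ : 0 ≤ Q)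
    (hh : 0 < h) : Summable fun k : ℕ => plateauGaussian ((a + k * h) / p - Q) :=
  summable_of_sum_range_le (fun _ => plateauGaussian_nonneg _)
    (sum_range_plateauGaussian_le ha hp hQ hh)

lemma tsum_plateauGaussian_le {a p Q h : ℝ} (ha : 0 ≤ a) (hp : 0 < p) (hQ : 0 ≤ Q)
    (hh : 0 < h) :
    ∑' k : ℕ, plateauGaussian ((a + k * h) / p - Q) ≤ 1 + p / h * (Q + √π / 2) :=
  Real.tsum_le_of_sum_range_le (fun _ => plateauGaussian_nonneg _)
    (sum_range_plateauGaussian_le ha hp hQ hh)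

/-- A Riemann sum over the lattice `hℤ` of a plateau with Gaussian tails centred at `c`. -/
lemma exists_hasSum_int_plateauGaussian_le {p Q h : ℝ} (c : ℝ) (hp : 0 < p) (hQ : 0 ≤ Q)
    (hh : 0 < h) :
    ∃ S, HasSum (fun n : ℤ => plateauGaussian (|(n : ℝ) * h - c| / p - Q)) S ∧
      S ≤ 2 + p / h * (2 * Q + √π) := by
  set m : ℤ := ⌈c / h⌉
  have hr : 0 ≤ m * h - c := by
    have := Int.le_ceil (c / h)
    rw [div_le_iff₀ hh] at this
    linarith
  have hl : 0 ≤ c - (m - 1) * h := by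
    have := Int.ceil_lt_add_one (c / h)
    rw [← sub_lt_iff_lt_add, lt_div_iff₀ hh] at this
    linarith
  have hsr := (summable_plateauGaussian hr hp hQ hh).hasSum
  have hsl := (summable_plateauGaussian hl hp hQ hh).hasSum
  refine ⟨_, (Equiv.addRight m).hasSum_iff.mp (HasSum.of_nat_of_neg_add_one
    (hsr.congr_fun ?_) (hsl.congr_fun ?_)), ?_⟩
  · intro k
    have hk : 0 ≤ (k : ℝ) * h := by positivity
    simp only [Function.comp, Equiv.coe_addRight]
    push_cast
    rw [show ((k : ℝ) + m) * h - c = m * h - c + k * h by ring, abs_of_nonneg (by linarith)]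
  · intro k
    have hk : 0 ≤ (k : ℝ) * h := by positivity
    simp only [Function.comp, Equiv.coe_addRight]
    push_cast
    rw [show (-((k : ℝ) + 1) + m) * h - c = -(c - (m - 1) * h + k * h) by ring, abs_neg,
      abs_of_nonneg (by linarith)]
  · have h1 := tsum_plateauGaussian_le hr hp hQ hh
    have h2 := tsum_plateauGaussian_le hl hp hQ hh
    linarith

lemma erfcR_sub_erfcR (a b : ℝ) :
    erfcR a - erfcR b = 2 / √π * ∫ t in a..b, Real.exp (-t ^ 2) := by
  unfold erfcR
  rw [← mul_sub, intervalIntegral.integral_Ioi_sub_Ioi' integrable_exp_neg_sq.integrableOn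
    integrable_exp_neg_sq.integrableOn]

lemma abs_erfcR_sub_erfcR_le {m a b : ℝ} (ha : m ≤ a) (hb : m ≤ b) :
    |erfcR a - erfcR b| ≤ 2 / √π * (plateauGaussian m * |b - a|) := by
  rw [erfcR_sub_erfcR, abs_mul, abs_of_nonneg (by positivity : 0 ≤ 2 / √π)]
  gcongr
  rw [← Real.norm_eq_abs]
  refine intervalIntegral.norm_integral_le_of_norm_le_const fun t ht => ?_
  rw [Real.norm_eq_abs, abs_of_pos (Real.exp_pos _)]
  exact (exp_neg_sq_le_plateauGaussian t).trans
    (antitone_plateauGaussian ((le_min ha hb).trans ht.1.le))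

lemma abs_wFn_shift_sub_le {p d : ℝ} (q x : ℝ) (hp : 0 < p) (hd : 0 ≤ d) :
    |wFn p q |x - d| - wFn p q (|x|)| ≤
      d / (√π * p) * plateauGaussian (|x - d / 2| / p - (q + d / (2 * p))) := by
  have hm : |x - d / 2| / p - (q + d / (2 * p)) = (|x - d / 2| - d / 2) / p - q := by
    field_simp
    ring
  have ha : |x - d / 2| - d / 2 ≤ |x - d| := by
    have := abs_sub_abs_le_abs_sub (x - d / 2) (x - d)
    rw [show x - d / 2 - (x - d) = d / 2 by ring, abs_of_nonneg (by positivity : 0 ≤ d / 2)] at this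
    linarith
  have hb : |x - d / 2| - d / 2 ≤ |x| := by
    have := abs_sub_abs_le_abs_sub (x - d / 2) x
    rw [show x - d / 2 - x = -(d / 2) by ring, abs_neg,
      abs_of_nonneg (by positivity : 0 ≤ d / 2)] at this
    linarith
  have hdist : |(|x| / p - q) - (|x - d| / p - q)| ≤ d / p := by
    rw [show (|x| / p - q) - (|x - d| / p - q) = (|x| - |x - d|) / p by ring, abs_div,
      abs_of_pos hp]
    gcongr
    simpa [abs_of_nonneg hd] using abs_abs_sub_abs_le_abs_sub x (x - d)
  rw [hm]
  have hle := abs_erfcR_sub_erfcR_le (m := (|x - d / 2| - d / 2) / p - q)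
    (a := |x - d| / p - q) (b := |x| / p - q) (by gcongr) (by gcongr)
  have hG := plateauGaussian_nonneg ((|x - d / 2| - d / 2) / p - q)
  unfold wFn
  rw [← mul_sub, abs_mul, abs_of_pos (by norm_num : (0 : ℝ) < 1 / 2)]
  calc _ ≤ 1 / 2 * (2 / √π * (plateauGaussian ((|x - d / 2| - d / 2) / p - q) * (d / p))) := by
        gcongr
        exact hle.trans (by gcongr)
    _ = _ := by
        have : √π ≠ 0 := by positivity
        field_simp

theorem stmt11 (p q h ε v : ℝ) (hp : 0 < p) (hq : 0 < q) (hh : 0 < h)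
    (hε : 0 < ε) (hv : 0 ≤ v) :
    h * ∑' n : ℤ, abs (wFn p q |(n : ℝ) * h - ε * v| - wFn p q |(n : ℝ) * h|) ≤
      ε * v / (Real.sqrt π * p) * (Real.sqrt π * p + 2 * h + 2 * p * q + ε * v) := by
  have hd : 0 ≤ ε * v := by positivity
  generalize ε * v = d at hd ⊢
  have hpi : 0 < √π := by positivity
  obtain ⟨S, hS, hSle⟩ := exists_hasSum_int_plateauGaussian_le (d / 2) hp
    (by positivity : 0 ≤ q + d / (2 * p)) hh
  have hbound : ∀ n : ℤ, |wFn p q |(n : ℝ) * h - d| - wFn p q (|(n : ℝ) * h|)| ≤ _ :=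
    fun n => abs_wFn_shift_sub_le q (n * h) hp hd
  have hS' := hS.mul_left (d / (√π * p))
  have hsum := Summable.of_nonneg_of_le (fun n => abs_nonneg _) hbound hS'.summable
  have htsum := hS'.tsum_eq ▸ hsum.tsum_le_tsum hbound hS'.summable
  calc _ ≤ h * (d / (√π * p) * (2 + p / h * (2 * (q + d / (2 * p)) + √π))) := by
        gcongr
        exact htsum.trans (by gcongr)
    _ = _ := by
        field_simp
        ring
end
end

section
/- For every real ω > 0, the (conditionally convergent, symmetrically truncated) Fourier transform of f₁(x) = 1/√(1 + x²) satisfies lim_{R→∞} ∫_{−R}^{R} e^{−iωx}/√(1 + x²) dx = 2 ∫_0^∞ e^{−ω cosh t} dt; that is, F₁(ω) = 2 K₀(ω), where K₀ denotes the modified Bessel function of the second kind of order zero, given by K₀(u) = ∫_0^∞ e^{−u cosh t} dt. -/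
open Real Complex Filter MeasureTheory intervalIntegral

noncomputable section

theorem integral_exp_div_sqrt_one_add_sq (ω A : ℝ) :
    ∫ x in (-Real.sinh A)..Real.sinh A,
        Complex.exp (-Complex.I * ω * x) / (Real.sqrt (1 + x ^ 2) : ℂ) =
      ∫ u in (-A)..A, Complex.exp (-Complex.I * ω * Complex.sinh u) := by
  have hpos (x : ℝ) : (Real.sqrt (1 + x ^ 2) : ℂ) ≠ 0 := by
    exact_mod_cast (Real.sqrt_pos.2 (by positivity)).ne'
  have h := integral_deriv_smul_comp (a := -A) (b := A) (f := Real.sinh) (f' := Real.cosh)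
    (g := fun x : ℝ => Complex.exp (-Complex.I * ω * x) / (Real.sqrt (1 + x ^ 2) : ℂ))
    (fun x _ => Real.hasDerivAt_sinh x) Real.continuous_cosh.continuousOn
    (Continuous.div (by fun_prop) (by fun_prop) hpos)
  rw [Real.sinh_neg] at h
  rw [← h]
  refine integral_congr fun u _ => ?_
  have hs : Real.sqrt (1 + Real.sinh u ^ 2) = Real.cosh u := by
    rw [add_comm, ← Real.cosh_sq, Real.sqrt_sq (Real.cosh_pos u).le]
  have hc : Complex.cosh u ≠ 0 := by exact_mod_cast (Real.cosh_pos u).ne'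
  simp only [Function.comp_apply, hs, Complex.real_smul, Complex.ofReal_cosh, Complex.ofReal_sinh]
  field_simp

theorem norm_exp_neg_I_mul_sinh (ω a y : ℝ) :
    ‖Complex.exp (-Complex.I * ω * Complex.sinh (a + y * Complex.I))‖ =
      Real.exp (ω * Real.cosh a * Real.sin y) := by
  rw [Complex.norm_exp, Complex.sinh_add, Complex.cosh_mul_I, Complex.sinh_mul_I,
    ← Complex.ofReal_sinh, ← Complex.ofReal_cosh, ← Complex.ofReal_sin, ← Complex.ofReal_cos]
  congr 1
  simp only [Complex.mul_re, Complex.mul_im, Complex.add_re, Complex.add_im, Complex.neg_re,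
    Complex.neg_im, Complex.I_re, Complex.I_im, Complex.ofReal_re, Complex.ofReal_im]
  ring

theorem exp_neg_I_mul_sinh_sub (ω u : ℝ) :
    Complex.exp (-Complex.I * ω * Complex.sinh (u + (-(π / 2) : ℝ) * Complex.I)) =
      (Real.exp (-ω * Real.cosh u) : ℂ) := by
  rw [Complex.sinh_add, Complex.cosh_mul_I, Complex.sinh_mul_I, ← Complex.ofReal_sin,
    ← Complex.ofReal_cos, Real.sin_neg, Real.cos_neg, Real.sin_pi_div_two, Real.cos_pi_div_two]
  push_cast
  congr 1
  linear_combination (ω * Complex.cosh u) * Complex.I_sq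

theorem tendsto_integral_vertical {ω : ℝ} (hω : 0 < ω) (s : ℝ → ℝ)
    (hs : ∀ A, Real.cosh (s A) = Real.cosh A) :
    Tendsto (fun A : ℝ => ∫ y in (-(π / 2))..0,
        Complex.exp (-Complex.I * ω * Complex.sinh (s A + y * Complex.I))) atTop (nhds 0) := by
  have hsin {y : ℝ} (hy : y ∈ Set.Ioo (-(π / 2)) 0) : Real.sin y < 0 :=
    Real.sin_neg_of_neg_of_neg_pi_lt hy.2 (by linarith [hy.1, Real.pi_pos])
  have hle : -(π / 2) ≤ 0 := by linarith [Real.pi_pos]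
  have hcosh : Tendsto Real.cosh atTop atTop :=
    tendsto_atTop_mono (fun x => (Real.sinh_lt_cosh x).le) Real.sinhOrderIso.tendsto_atTop
  simp only [intervalIntegral.integral_of_le hle, integral_Ioc_eq_integral_Ioo]
  rw [← integral_zero ℝ ℂ (μ := volume.restrict (Set.Ioo (-(π / 2)) 0))]
  refine tendsto_integral_filter_of_dominated_convergence (fun _ => 1) ?_ ?_ ?_ ?_
  · exact Eventually.of_forall fun A => Continuous.aestronglyMeasurable (by fun_prop)
  · refine Eventually.of_forall fun A => (ae_restrict_mem measurableSet_Ioo).mono fun y hy => ?_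
    rw [norm_exp_neg_I_mul_sinh, Real.exp_le_one_iff]
    exact mul_nonpos_of_nonneg_of_nonpos (mul_pos hω (Real.cosh_pos _)).le (hsin hy).le
  · exact integrable_const _
  · refine (ae_restrict_mem measurableSet_Ioo).mono fun y hy => ?_
    rw [tendsto_zero_iff_norm_tendsto_zero]
    simp only [norm_exp_neg_I_mul_sinh, hs]
    exact Real.tendsto_exp_atBot.comp
      ((hcosh.const_mul_atTop hω).atTop_mul_const_of_neg (hsin hy))

theorem integrableOn_exp_neg_mul_cosh {ω : ℝ} (hω : 0 < ω) :
    IntegrableOn (fun t => Real.exp (-ω * Real.cosh t)) (Set.Ioi 0) := by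
  refine (integrableOn_exp_mul_Ioi (neg_lt_zero.2 hω) 0).mono'
    (Continuous.aestronglyMeasurable (by fun_prop)) ?_
  refine (ae_restrict_mem measurableSet_Ioi).mono fun t ht => ?_
  rw [Real.norm_eq_abs, Real.abs_exp, Real.exp_le_exp]
  have : t ≤ Real.cosh t :=
    (Real.self_le_sinh_iff.2 (le_of_lt ht)).trans (Real.sinh_lt_cosh t).le
  nlinarith

theorem tendsto_integral_exp_neg_mul_cosh {ω : ℝ} (hω : 0 < ω) :
    Tendsto (fun A : ℝ => ∫ u in (-A)..A, Real.exp (-ω * Real.cosh u)) atTop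
      (nhds (2 * ∫ t in Set.Ioi (0 : ℝ), Real.exp (-ω * Real.cosh t))) := by
  have hc : Continuous fun u => Real.exp (-ω * Real.cosh u) := by fun_prop
  have h := (intervalIntegral_tendsto_integral_Ioi 0 (integrableOn_exp_neg_mul_cosh hω)
    tendsto_id).const_mul 2
  refine h.congr fun A => ?_
  have heven := intervalIntegral.integral_comp_neg (a := 0) (b := A)
    (fun u => Real.exp (-ω * Real.cosh u))
  simp only [Real.cosh_neg, neg_zero] at heven
  rw [← integral_add_adjacent_intervals (hc.intervalIntegrable (-A) 0)
    (hc.intervalIntegrable 0 A), ← heven, id, two_mul]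

theorem integral_exp_neg_I_mul_sinh (ω A : ℝ) :
    ∫ u in (-A)..A, Complex.exp (-Complex.I * ω * Complex.sinh u) =
      ((∫ u in (-A)..A, Real.exp (-ω * Real.cosh u) : ℝ) : ℂ) +
      Complex.I * (∫ y in (-(π / 2))..0,
        Complex.exp (-Complex.I * ω * Complex.sinh (A + y * Complex.I))) -
      Complex.I * (∫ y in (-(π / 2))..0,
        Complex.exp (-Complex.I * ω * Complex.sinh ((-A : ℝ) + y * Complex.I))) := by
  have h := Complex.integral_boundary_rect_eq_zero_of_differentiableOn
    (fun z => Complex.exp (-Complex.I * ω * Complex.sinh z)) ⟨-A, -(π / 2)⟩ ⟨A, 0⟩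
    (Differentiable.differentiableOn (by fun_prop))
  simp only [exp_neg_I_mul_sinh_sub, intervalIntegral.integral_ofReal, smul_eq_mul,
    Complex.ofReal_zero, zero_mul, add_zero] at h
  linear_combination -h

theorem stmt18 (ω : ℝ) (hω : 0 < ω) :
    Tendsto
      (fun R : ℝ => ∫ x in (-R)..R,
        Complex.exp (-Complex.I * ω * x) / (Real.sqrt (1 + x ^ 2) : ℂ))
      atTop
      (nhds ((2 * ∫ t in Set.Ioi (0 : ℝ), Real.exp (-ω * Real.cosh t) : ℝ) : ℂ)) := by
  have hmain := (((Complex.continuous_ofReal.tendsto _).comp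
    (tendsto_integral_exp_neg_mul_cosh hω)).add
    ((tendsto_integral_vertical hω id fun _ => rfl).const_mul Complex.I)).sub
    ((tendsto_integral_vertical hω Neg.neg Real.cosh_neg).const_mul Complex.I)
  rw [mul_zero, add_zero, sub_zero] at hmain
  refine (hmain.comp Real.sinhOrderIso.symm.tendsto_atTop).congr fun R => ?_
  have hR : Real.sinh (Real.sinhOrderIso.symm R) = R := Real.sinhOrderIso.apply_symm_apply R
  have h := integral_exp_div_sqrt_one_add_sq ω (Real.sinhOrderIso.symm R)
  rw [hR, integral_exp_neg_I_mul_sinh] at h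
  exact h.symm
end
end
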